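/- Suppose the dynamical system (X,T,μ) satisfies the polynomial concentration inequality with moment q = 2 and constant C₂ > 0. Then there exists a constant D₂ > 0 such that for every ε > 0, every Lipschitz function φ : ℝ → ℝ, every r > 0, and every n ≥ 1, the observed correlation-integral estimator K̃^φ_{n,r}(y_0,…,y_{n−1}) = (1/n²) Σ_{i ≠ j} φ(1 − ‖y_i − y_j‖/r) satisfies Var_{μ_n ⊗ P^n}(K̃^φ_{n,r}) ≤ D₂ Lip(φ)² (1 + ε)² / (r² n), where Var(Y) = E[Y²] − (E[Y])². -/

import Mathlib

open MeasureTheory Real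

noncomputable section

/-- `K` is separately Lipschitz in each of its `n` variables, with
`L j` a Lipschitz constant for the `j`-th variable. -/
def SepLip {E : Type*} [PseudoMetricSpace E] {n : ℕ}
    (K : (Fin n → E) → ℝ) (L : Fin n → ℝ) : Prop :=
  ∀ (x : Fin n → E) (j : Fin n) (y : E),
    |K x - K (Function.update x j y)| ≤ L j * dist (x j) y

/-- The smoothed observed correlation-integral estimator
`K̃^φ_{n,r}(y₀,…,y_{n-1}) = (1/n²) ∑_{i ≠ j} φ(1 - ‖y_i - y_j‖ / r)`,
where `y_i = T^i x + ε ξ_i`. -/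
def obsCorrEstimator {d n : ℕ}
    (T : EuclideanSpace ℝ (Fin d) → EuclideanSpace ℝ (Fin d)) (ε : ℝ) (φ : ℝ → ℝ)
    (r : ℝ) (p : EuclideanSpace ℝ (Fin d) × (Fin n → EuclideanSpace ℝ (Fin d))) : ℝ :=
  (1 / (n : ℝ) ^ 2) * ∑ i : Fin n, ∑ j : Fin n,
    if i = j then 0 else
      φ (1 - ‖(T^[(i : ℕ)] p.1 + ε • p.2 i) - (T^[(j : ℕ)] p.1 + ε • p.2 j)‖ / r)

open ProbabilityTheory in
lemma var_prod_le {α β : Type*} [MeasurableSpace α] [MeasurableSpace β]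
    (ν : Measure α) (ρ : Measure β) [IsProbabilityMeasure ν] [IsProbabilityMeasure ρ]
    (F : α × β → ℝ) (hF : Measurable F) (C : ℝ) (hC : ∀ᵐ p ∂(ν.prod ρ), |F p| ≤ C)
    (a b : ℝ) (ha : ∀ᵐ y ∂ρ, variance (fun x => F (x, y)) ν ≤ a)
    (hb : variance (fun y => ∫ x, F (x, y) ∂ν) ρ ≤ b) :
    variance F (ν.prod ρ) ≤ a + b := by
  have hFm : MemLp F 2 (ν.prod ρ) :=
    MemLp.of_bound hF.aestronglyMeasurable C hC
  have hC' : ∀ᵐ y ∂ρ, ∀ᵐ x ∂ν, |F (x, y)| ≤ C := by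
    have h1 : ∀ᵐ q ∂(ρ.prod ν), |F q.swap| ≤ C :=
      (Measure.measurePreserving_swap (μ := ρ) (ν := ν)).quasiMeasurePreserving.ae hC
    exact Measure.ae_ae_of_ae_prod h1
  have hgm : Measurable (fun y => ∫ x, F (x, y) ∂ν) :=
    (hF.stronglyMeasurable.integral_prod_left').measurable
  have hgb : ∀ᵐ y ∂ρ, ‖∫ x, F (x, y) ∂ν‖ ≤ C := by
    filter_upwards [hC'] with y hy
    have := norm_integral_le_of_norm_le_const (μ := ν) (f := fun x => F (x, y)) (C := C) hy
    simpa using this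
  have hg : MemLp (fun y => ∫ x, F (x, y) ∂ν) 2 ρ :=
    MemLp.of_bound hgm.aestronglyMeasurable C hgb
  rw [variance_eq_sub hFm]
  rw [variance_eq_sub hg] at hb
  have hF1 : Integrable F (ν.prod ρ) := hFm.integrable (by norm_num)
  have hF2 : Integrable (fun p => F p ^ 2) (ν.prod ρ) := hFm.integrable_sq
  have e1 : ∫ p, F p ∂(ν.prod ρ) = ∫ y, ∫ x, F (x, y) ∂ν ∂ρ := integral_prod_symm _ hF1
  have e2 : ∫ p, F p ^ 2 ∂(ν.prod ρ) = ∫ y, ∫ x, F (x, y) ^ 2 ∂ν ∂ρ := integral_prod_symm _ hF2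
  have e3 : ∫ y, ∫ x, F (x, y) ^ 2 ∂ν ∂ρ ≤ ∫ y, (a + (∫ x, F (x, y) ∂ν) ^ 2) ∂ρ := by
    apply integral_mono_ae hF2.integral_prod_right ((integrable_const a).add hg.integrable_sq)
    filter_upwards [ha, hC'] with y hy hc
    have hm : MemLp (fun x => F (x, y)) 2 ν :=
      MemLp.of_bound (hF.comp (by fun_prop : Measurable fun x => (x, y))).aestronglyMeasurable C hc
    rw [variance_eq_sub hm] at hy
    simp only [Pi.pow_apply] at hy ⊢
    simp only [Pi.add_apply]
    linarith
  rw [integral_add (integrable_const a) hg.integrable_sq] at e3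
  simp only [Pi.pow_apply, integral_const, probReal_univ, smul_eq_mul, one_mul] at *
  rw [e1, e2]
  linarith

lemma SepLip.abs_sub_le {E : Type*} [PseudoMetricSpace E] {n : ℕ}
    {K : (Fin n → E) → ℝ} {c : ℝ} (h : SepLip K (fun _ => c)) (x y : Fin n → E) :
    |K x - K y| ≤ c * ∑ j, dist (x j) (y j) := by
  have key : ∀ s : Finset (Fin n),
      |K x - K (s.piecewise y x)| ≤ c * ∑ j ∈ s, dist (x j) (y j) := by
    intro s
    induction s using Finset.induction_on with
    | empty => simp
    | insert j s hj ih =>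
      rw [Finset.piecewise_insert, Finset.sum_insert hj]
      have h1 := h (s.piecewise y x) j (y j)
      have h2 : s.piecewise y x j = x j := by simp [hj]
      rw [h2] at h1
      have h3 := _root_.abs_sub_le (K x) (K (s.piecewise y x))
        (K (Function.update (s.piecewise y x) j (y j)))
      simp only at h1
      linarith
  simpa using key Finset.univ

lemma SepLip.continuous' {E : Type*} [PseudoMetricSpace E] {n : ℕ}
    {K : (Fin n → E) → ℝ} {c : ℝ} (hc : 0 ≤ c) (h : SepLip K (fun _ => c)) : Continuous K := by
  apply LipschitzWith.continuous (K := Real.toNNReal (c * n))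
  apply LipschitzWith.of_dist_le'
  intro x y
  rw [Real.dist_eq]
  refine (h.abs_sub_le x y).trans ?_
  rw [mul_assoc]
  gcongr
  calc ∑ j, dist (x j) (y j) ≤ ∑ j : Fin n, dist x y :=
        Finset.sum_le_sum fun j _ => dist_le_pi_dist x y j
    _ = n * dist x y := by simp

lemma SepLip.bound {E : Type*} [SeminormedAddCommGroup E] {n : ℕ}
    {K : (Fin n → E) → ℝ} {c : ℝ} (hc : 0 ≤ c) (h : SepLip K (fun _ => c)) (M : ℝ)
    (x : Fin n → E) (hx : ∀ i, ‖x i‖ ≤ M) : |K x| ≤ |K 0| + c * (n * M) := by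
  have h1 := h.abs_sub_le x 0
  have h2 : ∑ j, dist (x j) ((0 : Fin n → E) j) ≤ n * M := by
    calc ∑ j, dist (x j) ((0 : Fin n → E) j) ≤ ∑ j : Fin n, M :=
          Finset.sum_le_sum fun j _ => by simpa using hx j
      _ = n * M := by simp
  have h3 := mul_le_mul_of_nonneg_left h2 hc
  have h4 := abs_sub_abs_le_abs_sub (K x) (K 0)
  linarith

lemma ae_pi_bound {E : Type*} [SeminormedAddCommGroup E] [MeasurableSpace E] {n : ℕ}
    (P : Measure E) [IsProbabilityMeasure P] (hP : ∀ᵐ ξ ∂P, ‖ξ‖ ≤ 1) :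
    ∀ᵐ ξ ∂(Measure.pi fun _ : Fin n => P), ∀ i, ‖ξ i‖ ≤ 1 := by
  rw [ae_all_iff]
  intro i
  exact (measurePreserving_eval (fun _ : Fin n => P) i).quasiMeasurePreserving.ae hP

/-- averaging preserves SepLip -/
lemma SepLip.integral {α E : Type*} [MeasurableSpace α] [PseudoMetricSpace E] {n : ℕ}
    (ν : Measure α) [IsProbabilityMeasure ν] (f : α → (Fin n → E) → ℝ) (c : ℝ)
    (hi : ∀ ξ, Integrable (fun a => f a ξ) ν)
    (hf : ∀ a, SepLip (f a) (fun _ => c)) :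
    SepLip (fun ξ => ∫ a, f a ξ ∂ν) (fun _ => c) := by
  intro ξ j y
  simp only
  rw [← integral_sub (hi _) (hi _)]
  have := norm_integral_le_of_norm_le_const (μ := ν)
    (f := fun a => f a ξ - f a (Function.update ξ j y)) (C := c * dist (ξ j) y)
    (Filter.Eventually.of_forall fun a => hf a ξ j y)
  simpa using this

open ProbabilityTheory in
lemma var_pi_le {d : ℕ} (P : Measure (EuclideanSpace ℝ (Fin d))) [IsProbabilityMeasure P]
    (hP : ∀ᵐ ξ ∂P, ‖ξ‖ ≤ 1) (c : ℝ) (hc : 0 ≤ c) (n : ℕ) :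
    ∀ (f : (Fin n → EuclideanSpace ℝ (Fin d)) → ℝ), SepLip f (fun _ => c) →
    variance f (Measure.pi fun _ : Fin n => P) ≤ n * c ^ 2 := by
  induction n with
  | zero =>
    intro f hf
    have : f = fun _ => f 0 := by
      funext x; congr 1; exact Subsingleton.elim _ _
    rw [this, variance_eq_integral (by fun_prop)]
    simp
  | succ n ih =>
    intro f hf
    have hcont := hf.continuous' hc
    let F : EuclideanSpace ℝ (Fin d) × (Fin n → EuclideanSpace ℝ (Fin d)) → ℝ :=
      fun p => f (Fin.cons p.1 p.2)
    have hFc : Continuous F := hcont.comp (by fun_prop)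
    have hmp := measurePreserving_piFinSuccAbove (fun _ : Fin (n+1) => P) 0
    have hfF : f = F ∘ (MeasurableEquiv.piFinSuccAbove
        (fun _ : Fin (n+1) => EuclideanSpace ℝ (Fin d)) 0) := by
      funext x
      simp only [F, Function.comp, MeasurableEquiv.piFinSuccAbove_apply]
      congr 1
      exact (Fin.cons_self_tail x).symm
    have hvar : variance f (Measure.pi fun _ : Fin (n+1) => P)
        = variance F (P.prod (Measure.pi fun _ : Fin n => P)) := by
      conv_lhs => rw [hfF]
      rw [← hmp.map_eq, variance_map hFc.measurable.aemeasurable hmp.measurable.aemeasurable]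
    rw [hvar]
    have hint : ∀ t, MemLp (fun h => F (h, t)) 2 P := by
      intro t
      refine MemLp.of_bound (by fun_prop) (|f (Fin.cons 0 t)| + c) ?_
      filter_upwards [hP] with h hh
      have h1 := hf (Fin.cons h t) 0 0
      simp only [Fin.cons_zero, Fin.update_cons_zero, dist_zero_right] at h1
      have h2 := abs_sub_abs_le_abs_sub (f (Fin.cons h t)) (f (Fin.cons 0 t))
      have h3 : c * ‖h‖ ≤ c * 1 := by gcongr
      simp only [F, Real.norm_eq_abs]
      linarith
    have := var_prod_le P (Measure.pi fun _ : Fin n => P) F hFc.measurable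
      (|f 0| + c * ((n + 1 : ℕ) * 1)) ?_ (c ^ 2) (n * c ^ 2) ?_ ?_
    · push_cast; linarith
    · have := (hmp.symm).quasiMeasurePreserving.ae (ae_pi_bound (n := n + 1) P hP)
      filter_upwards [this] with p hp
      apply hf.bound hc 1
      have e : (MeasurableEquiv.piFinSuccAbove
          (fun _ : Fin (n+1) => EuclideanSpace ℝ (Fin d)) 0).symm p = Fin.cons p.1 p.2 := by
        rw [MeasurableEquiv.symm_apply_eq, MeasurableEquiv.piFinSuccAbove_apply]
        rfl
      intro i
      have h2 := hp i
      rw [e] at h2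
      exact h2
    · refine Filter.Eventually.of_forall fun t => ?_
      rw [← variance_sub_const (hint t).1 (f (Fin.cons 0 t))]
      refine (variance_le_expectation_sq (by fun_prop)).trans ?_
      have hb : ∀ᵐ h ∂P, ‖((fun h => F (h, t) - f (Fin.cons 0 t)) ^ 2) h‖ ≤ c ^ 2 := by
        filter_upwards [hP] with h hh
        have h1 := hf (Fin.cons h t) 0 0
        simp only [Fin.cons_zero, Fin.update_cons_zero, dist_zero_right] at h1
        have h3 : c * ‖h‖ ≤ c * 1 := by gcongr
        simp only [F, Pi.pow_apply, norm_pow, Real.norm_eq_abs]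
        apply pow_le_pow_left₀ (abs_nonneg _)
        linarith
      have := norm_integral_le_of_norm_le_const hb
      simp only [probReal_univ, mul_one] at this
      exact (le_abs_self _).trans this
    · apply ih
      apply SepLip.integral P (fun h t => F (h, t)) c
      · exact fun t => (hint t).integrable (by norm_num)
      · intro h t j y
        have h1 := hf (Fin.cons h t) j.succ y
        rw [← Fin.cons_update] at h1
        simpa [F] using h1

/-- The kernel of the estimator. -/
def corrK {d n : ℕ} (φ : ℝ → ℝ) (r : ℝ) (y : Fin n → EuclideanSpace ℝ (Fin d)) : ℝ :=
  (1 / (n : ℝ) ^ 2) * ∑ i : Fin n, ∑ j : Fin n,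
    if i = j then 0 else φ (1 - ‖y i - y j‖ / r)

lemma corrK_sepLip {d n : ℕ} (hn : 1 ≤ n) (φ : ℝ → ℝ) (Lφ : ℝ) (hL : 0 ≤ Lφ)
    (hφ : ∀ a b : ℝ, |φ a - φ b| ≤ Lφ * |a - b|) (r : ℝ) (hr : 0 < r) :
    SepLip (corrK (d := d) (n := n) φ r) (fun _ => 2 * Lφ / (r * n)) := by
  intro y k z
  have hn0 : (0 : ℝ) < n := by exact_mod_cast hn
  set y' := Function.update y k z with hy'
  have hsum : ∑ i, dist (y i) (y' i) = dist (y k) z := by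
    rw [Finset.sum_eq_single k]
    · simp [hy']
    · intro b _ hb; simp [hy', hb]
    · simp
  have hterm : ∀ i j : Fin n, |(if i = j then 0 else φ (1 - ‖y i - y j‖ / r))
      - (if i = j then 0 else φ (1 - ‖y' i - y' j‖ / r))|
      ≤ Lφ / r * (dist (y i) (y' i) + dist (y j) (y' j)) := by
    intro i j
    split_ifs
    · simp; positivity
    · refine (hφ _ _).trans ?_
      have e : (1 - ‖y i - y j‖ / r) - (1 - ‖y' i - y' j‖ / r)
          = (‖y' i - y' j‖ - ‖y i - y j‖) / r := by ring
      rw [e, abs_div, abs_of_pos hr, div_mul_eq_mul_div, mul_div_assoc]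
      gcongr
      refine (abs_norm_sub_norm_le _ _).trans ?_
      have e2 : y' i - y' j - (y i - y j) = (y j - y' j) - (y i - y' i) := by abel
      rw [e2, dist_eq_norm, dist_eq_norm, add_comm]
      exact norm_sub_le _ _
  unfold corrK
  rw [← mul_sub, ← Finset.sum_sub_distrib, abs_mul, abs_of_pos (by positivity)]
  simp_rw [← Finset.sum_sub_distrib]
  have : |∑ i : Fin n, ∑ j : Fin n, ((if i = j then 0 else φ (1 - ‖y i - y j‖ / r))
      - (if i = j then 0 else φ (1 - ‖y' i - y' j‖ / r)))|
      ≤ Lφ / r * (2 * n * dist (y k) z) := by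
    refine (Finset.abs_sum_le_sum_abs _ _).trans ?_
    calc _ ≤ ∑ i : Fin n, ∑ j : Fin n, Lφ / r * (dist (y i) (y' i) + dist (y j) (y' j)) := by
          refine Finset.sum_le_sum fun i _ => (Finset.abs_sum_le_sum_abs _ _).trans ?_
          exact Finset.sum_le_sum fun j _ => hterm i j
      _ = _ := by
          simp_rw [← Finset.mul_sum, Finset.sum_add_distrib]
          rw [hsum]
          simp only [Finset.sum_const, Finset.card_univ, Fintype.card_fin, nsmul_eq_mul]
          rw [← Finset.mul_sum, hsum]; ring
  calc _ ≤ 1 / (n : ℝ) ^ 2 * (Lφ / r * (2 * n * dist (y k) z)) := by gcongr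
    _ = _ := by field_simp

/-- Variance bound for the smoothed observed correlation-integral estimator for a
system satisfying the polynomial concentration inequality with moment `q = 2`:
`Var(K̃^φ_{n,r}) ≤ D₂ Lip(φ)² (1+ε)² / (r² n)`. -/
theorem observed_correlation_estimator_variance {d : ℕ}
    (X : Set (EuclideanSpace ℝ (Fin d))) (hX : IsCompact X)
    (T : EuclideanSpace ℝ (Fin d) → EuclideanSpace ℝ (Fin d))
    (hT : Measurable T) (hTX : Set.MapsTo T X X)
    (μ : Measure (EuclideanSpace ℝ (Fin d))) [IsProbabilityMeasure μ]
    (hμX : μ X = 1) (hinv : μ.map T = μ)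
    (C2 : ℝ) (hC2 : 0 < C2)
    (hconc : ∀ (n : ℕ), 1 ≤ n → ∀ (K : (Fin n → EuclideanSpace ℝ (Fin d)) → ℝ)
      (L : Fin n → ℝ), SepLip K L →
      ∫ x, |K (fun i => T^[(i : ℕ)] x)
          - ∫ z, K (fun i => T^[(i : ℕ)] z) ∂μ| ^ 2 ∂μ
        ≤ C2 * ∑ j, L j ^ 2)
    (P : Measure (EuclideanSpace ℝ (Fin d))) [IsProbabilityMeasure P]
    (hP : ∀ᵐ ξ ∂P, ‖ξ‖ ≤ 1) :
    ∃ D2 : ℝ, 0 < D2 ∧ ∀ ε : ℝ, 0 < ε → ∀ (φ : ℝ → ℝ) (Lφ : ℝ), 0 ≤ Lφ →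
      (∀ a b : ℝ, |φ a - φ b| ≤ Lφ * |a - b|) →
      ∀ r : ℝ, 0 < r → ∀ (n : ℕ), 1 ≤ n →
      (∫ p, (obsCorrEstimator T ε φ r p) ^ 2
          ∂(μ.prod (Measure.pi fun _ : Fin n => P)))
        - (∫ p, obsCorrEstimator T ε φ r p
            ∂(μ.prod (Measure.pi fun _ : Fin n => P))) ^ 2
        ≤ D2 * Lφ ^ 2 * (1 + ε) ^ 2 / (r ^ 2 * (n : ℝ)) := by
  classical
  refine ⟨4 * (C2 + 1), by positivity, ?_⟩
  intro ε hε φ Lφ hL hφ r hr n hn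
  have hn0 : (0 : ℝ) < n := by exact_mod_cast hn
  set c : ℝ := 2 * Lφ / (r * n) with hcdef
  have hc : 0 ≤ c := by positivity
  have hK := corrK_sepLip (d := d) hn φ Lφ hL hφ r hr
  rw [← hcdef] at hK
  have hKc := hK.continuous' hc
  set F : EuclideanSpace ℝ (Fin d) × (Fin n → EuclideanSpace ℝ (Fin d)) → ℝ :=
    obsCorrEstimator T ε φ r with hFdef
  have hFK : ∀ x ξ, F (x, ξ) = corrK φ r (fun i : Fin n => T^[(i : ℕ)] x + ε • ξ i) :=
    fun x ξ => rfl
  have hFm : Measurable F := by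
    have : F = (corrK φ r) ∘ (fun p i => T^[((i : Fin n) : ℕ)] p.1 + ε • p.2 i) := rfl
    rw [this]
    refine hKc.measurable.comp (measurable_pi_lambda _ fun i => ?_)
    exact ((hT.iterate i).comp measurable_fst).add
      (((measurable_pi_apply i).comp measurable_snd).const_smul ε)
  obtain ⟨M, hM⟩ := hX.isBounded.exists_norm_le
  have hxX : ∀ᵐ x ∂μ, x ∈ X := (mem_ae_iff_prob_eq_one hX.measurableSet).2 hμX
  have hTb : ∀ x ∈ X, ∀ i : ℕ, ‖T^[i] x‖ ≤ M := fun x hx i => hM _ (hTX.iterate i hx)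
  have hbd : ∀ x ∈ X, ∀ (ξ : Fin n → EuclideanSpace ℝ (Fin d)) (R : ℝ), (∀ i, ‖ξ i‖ ≤ R) →
      |F (x, ξ)| ≤ |corrK (d := d) (n := n) φ r 0| + c * (n * (M + ε * R)) := by
    intro x hx ξ R hR
    rw [hFK]
    apply hK.bound hc
    intro i
    refine (norm_add_le _ _).trans ?_
    rw [norm_smul, Real.norm_eq_abs, abs_of_pos hε]
    have := hTb x hx i
    have := hR i
    gcongr
  have hbF : ∀ᵐ p ∂(μ.prod (Measure.pi fun _ : Fin n => P)),
      |F p| ≤ |corrK (d := d) (n := n) φ r 0| + c * (n * (M + ε * 1)) := by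
    have h1 := (Measure.quasiMeasurePreserving_fst (μ := μ)
      (ν := Measure.pi fun _ : Fin n => P)).ae hxX
    have h2 := (Measure.quasiMeasurePreserving_snd (μ := μ)
      (ν := Measure.pi fun _ : Fin n => P)).ae (ae_pi_bound (n := n) P hP)
    filter_upwards [h1, h2] with p hp1 hp2
    exact hbd p.1 hp1 p.2 1 hp2
  have hmx : ∀ ξ, Measurable (fun x => F (x, ξ)) := fun ξ => hFm.comp (by fun_prop)
  have hix : ∀ ξ, Integrable (fun x => F (x, ξ)) μ := by
    intro ξ
    refine Integrable.of_bound (hmx ξ).aestronglyMeasurable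
      (|corrK (d := d) (n := n) φ r 0| + c * (n * (M + ε * ‖ξ‖))) ?_
    filter_upwards [hxX] with x hx
    exact hbd x hx ξ ‖ξ‖ (fun i => norm_le_pi_norm ξ i)
  have hvar := var_prod_le μ (Measure.pi fun _ : Fin n => P) F hFm _ hbF
    (C2 * (n * c ^ 2)) (n * (c * ε) ^ 2) ?_ ?_
  · have hmem : MemLp F 2 (μ.prod (Measure.pi fun _ : Fin n => P)) :=
      MemLp.of_bound hFm.aestronglyMeasurable _ hbF
    rw [ProbabilityTheory.variance_eq_sub hmem] at hvar
    simp only [Pi.pow_apply] at hvar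
    refine hvar.trans ?_
    have e1 : C2 * (n * c ^ 2) + n * (c * ε) ^ 2
        = 4 * (C2 + ε ^ 2) * (Lφ ^ 2 / (r ^ 2 * n)) := by
      rw [hcdef]; field_simp; ring
    have e2 : 4 * (C2 + 1) * Lφ ^ 2 * (1 + ε) ^ 2 / (r ^ 2 * (n : ℝ))
        = 4 * ((C2 + 1) * (1 + ε) ^ 2) * (Lφ ^ 2 / (r ^ 2 * n)) := by ring
    rw [e1, e2]
    gcongr
    nlinarith [mul_pos hC2 hε, mul_pos hC2 (mul_pos hε hε)]
  · refine Filter.Eventually.of_forall fun ξ => ?_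
    rw [ProbabilityTheory.variance_eq_integral (hmx ξ).aemeasurable]
    have := hconc n hn (fun y => corrK φ r (fun i => y i + ε • ξ i)) (fun _ => c) ?_
    · simp only [sq_abs, Finset.sum_const, Finset.card_univ, Fintype.card_fin,
        nsmul_eq_mul] at this
      exact this
    · intro y j z
      have h1 := hK (fun i => y i + ε • ξ i) j (z + ε • ξ j)
      have e : (fun i => Function.update y j z i + ε • ξ i)
          = Function.update (fun i => y i + ε • ξ i) j (z + ε • ξ j) := by
        funext i
        by_cases h : i = j
        · subst h; simp
        · simp [h]
      simp only [e]
      simpa using h1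
  · apply var_pi_le P hP (c * ε) (by positivity)
    apply SepLip.integral μ (fun x ξ => F (x, ξ)) (c * ε) hix
    intro x ξ j z
    have h1 := hK (fun i => T^[(i : ℕ)] x + ε • ξ i) j (T^[(j : ℕ)] x + ε • z)
    have e : (fun i : Fin n => T^[(i : ℕ)] x + ε • Function.update ξ j z i)
        = Function.update (fun i : Fin n => T^[(i : ℕ)] x + ε • ξ i) j
          (T^[(j : ℕ)] x + ε • z) := by
      funext i
      by_cases h : i = j
      · subst h; simp
      · simp [h]
    simp only [hFK, e]
    refine h1.trans (le_of_eq ?_)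
    simp only [dist_add_left, dist_smul₀, Real.norm_eq_abs, abs_of_pos hε]
    ring
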